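/- arXiv:math-ph/0403029 — 3 statements merged into one kernel-verified Lean document; each statement's English description precedes it below -/
import Mathlib

section
/- Let X_r be a random variable with the χ_r distribution. Then, as r → ∞, the random variable X_r − √r converges in distribution to the normal distribution with mean 0 and variance 1/2. -/
open MeasureTheory ProbabilityTheory Filter Polynomial Matrix Topology Asymptotics

instance matrixMeasurableSpace {m n α : Type*} [MeasurableSpace α] :
    MeasurableSpace (Matrix m n α) := MeasurableSpace.pi

noncomputable section

/-- The chi distribution with parameter `r`: the measure on `ℝ` with density
`2^(1-r/2) x^(r-1) e^(-x²/2) / Γ(r/2)` on `(0,∞)`. -/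
def chiMeasure (r : ℝ) : Measure ℝ :=
  volume.withDensity fun x => ENNReal.ofReal
    (Set.indicator (Set.Ioi (0:ℝ))
      (fun x => (2:ℝ) ^ (1 - r / 2) * x ^ (r - 1) * Real.exp (-x ^ 2 / 2) / Real.Gamma (r / 2)) x)

/-- The `i`-th largest root of the characteristic polynomial (counted with multiplicity);
for a real symmetric matrix this is its `i`-th largest eigenvalue. -/
def ithLargestEig {n : ℕ} (M : Matrix (Fin n) (Fin n) ℝ) (i : Fin n) : ℝ :=
  (M.charpoly.roots.sort (· ≤ ·)).getD (n - 1 - (i : ℕ)) 0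

def finL {k : ℕ} (l : Fin (k - 1)) : Fin k := ⟨l, by have := l.isLt; omega⟩
def finR {k : ℕ} (l : Fin (k - 1)) : Fin k := ⟨(l : ℕ) + 1, by have := l.isLt; omega⟩

/-- Symmetric tridiagonal matrix with diagonal `d` and off-diagonal `e`. -/
def symTridiagOf {k : ℕ} (d : Fin k → ℝ) (e : Fin (k - 1) → ℝ) : Matrix (Fin k) (Fin k) ℝ :=
  Matrix.of fun i j =>
    if i = j then d i
    else if h : (i : ℕ) + 1 = (j : ℕ) then e ⟨i, by have := j.isLt; omega⟩
    else if h' : (j : ℕ) + 1 = (i : ℕ) then e ⟨j, by have := i.isLt; omega⟩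
    else 0

/-- Lower bidiagonal matrix with diagonal `d` and subdiagonal `e`. -/
def lowerBidiagOf {k : ℕ} (d : Fin k → ℝ) (e : Fin (k - 1) → ℝ) : Matrix (Fin k) (Fin k) ℝ :=
  Matrix.of fun i j =>
    if i = j then d i
    else if h : (j : ℕ) + 1 = (i : ℕ) then e ⟨j, by have := i.isLt; omega⟩
    else 0

/-- The Hermite polynomials, orthonormal with respect to the weight `e^(-x²)` on `ℝ`,
with positive leading coefficients; they satisfy
`x·H n x = √((n+1)/2)·H (n+1) x + √(n/2)·H (n-1) x`. -/
def Hpoly : ℕ → ℝ → ℝ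
  | 0 => fun _ => Real.pi ^ (-(1:ℝ)/4)
  | 1 => fun x => Real.sqrt 2 * x * Real.pi ^ (-(1:ℝ)/4)
  | (n+2) => fun x =>
      (x * Hpoly (n+1) x - Real.sqrt (((n:ℝ)+1)/2) * Hpoly n x) / Real.sqrt (((n:ℝ)+2)/2)

/-- The monic (probabilists') Hermite polynomials:
`He 0 = 1`, `He 1 = X`, `He (n+1) = X·He n - n·He (n-1)`. -/
def heP : ℕ → Polynomial ℝ
  | 0 => 1
  | 1 => Polynomial.X
  | (n+2) => Polynomial.X * heP (n+1) - Polynomial.C ((n:ℝ)+1) * heP n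

/-- The generalized Laguerre polynomials of parameter `γ`, orthonormal with respect to the
weight `x^γ e^(-x)` on `[0,∞)` (formally defined for all real `γ`), with positive leading
coefficients; they satisfy
`x·L n x = √((n+1)(n+γ+1))·L (n+1) x + (2n+γ+1)·L n x + √(n(n+γ))·L (n-1) x`. -/
def Lag (γ : ℝ) : ℕ → ℝ → ℝ
  | 0 => fun _ => Real.Gamma (γ+1) ^ (-(1:ℝ)/2)
  | 1 => fun x => (x - (γ+1)) * Real.Gamma (γ+1) ^ (-(1:ℝ)/2) / Real.sqrt (γ+1)
  | (n+2) => fun x =>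
      ((x - (2*((n:ℝ)+1)+γ+1)) * Lag γ (n+1) x
        - Real.sqrt (((n:ℝ)+1)*(((n:ℝ)+1)+γ)) * Lag γ n x)
      / Real.sqrt (((n:ℝ)+2)*(((n:ℝ)+2)+γ))

/-- The fixed `k×k` symmetric tridiagonal matrix `H` with zero diagonal and off-diagonal
entries `√(k-j)/√2`, `j = 1,…,k-1`. -/
def hermiteH (k : ℕ) : Matrix (Fin k) (Fin k) ℝ :=
  symTridiagOf (fun _ => 0) (fun j => Real.sqrt ((k:ℝ) - 1 - (j:ℕ)) / Real.sqrt 2)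

/-- The fixed `k×k` lower bidiagonal matrix `B_γ` with diagonal `√(γ+k-j)` and
subdiagonal `√(k-j)`. -/
def lagB (k : ℕ) (γ : ℝ) : Matrix (Fin k) (Fin k) ℝ :=
  lowerBidiagOf (fun j => Real.sqrt (γ + (k:ℝ) - 1 - (j:ℕ)))
    (fun j => Real.sqrt ((k:ℝ) - 1 - (j:ℕ)))

/-- The fixed tridiagonal Laguerre matrix `L_γ = B_γ B_γᵀ`. -/
def lagL (k : ℕ) (γ : ℝ) : Matrix (Fin k) (Fin k) ℝ := lagB k γ * (lagB k γ)ᵀ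

/-- Law of the β-Hermite tridiagonal matrix model of size `k`, scaled by `1/√(2kβ)`:
independent `N(0,1)` diagonal entries and `(1/√2)·χ_((k-j)β)` off-diagonal entries. -/
def hermiteLaw (k : ℕ) (β : ℝ) : Measure (Matrix (Fin k) (Fin k) ℝ) :=
  Measure.map (fun p : (Fin k → ℝ) × (Fin (k-1) → ℝ) =>
      (Real.sqrt (2 * (k:ℝ) * β))⁻¹ • symTridiagOf p.1 p.2)
    ((Measure.pi fun _ : Fin k => gaussianReal 0 1).prod
      (Measure.pi fun j : Fin (k-1) =>
        Measure.map (fun x => x / Real.sqrt 2) (chiMeasure (((k:ℝ) - 1 - (j:ℕ)) * β))))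

/-- Law of the limiting symmetric tridiagonal Gaussian matrix `Z` (Hermite case):
i.i.d. `N(0,1)` diagonal entries and i.i.d. `N(0,1/4)` off-diagonal entries. -/
def zLaw (k : ℕ) : Measure (Matrix (Fin k) (Fin k) ℝ) :=
  Measure.map (fun p : (Fin k → ℝ) × (Fin (k-1) → ℝ) => symTridiagOf p.1 p.2)
    ((Measure.pi fun _ : Fin k => gaussianReal 0 1).prod
      (Measure.pi fun _ : Fin (k-1) => gaussianReal 0 (1/4)))

/-- Law of the β-Laguerre matrix model of size `k` with parameter `a`, scaled by `1/(kβ)`: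
`B = (1/(kβ)) X Xᵀ` with `X` lower bidiagonal, `X_jj ~ χ_(2a-β(j-1))`, `X_(j+1,j) ~ χ_(β(k-j))`. -/
def lagLaw (k : ℕ) (β a : ℝ) : Measure (Matrix (Fin k) (Fin k) ℝ) :=
  Measure.map (fun p : (Fin k → ℝ) × (Fin (k-1) → ℝ) =>
      (((k:ℝ) * β)⁻¹) • (lowerBidiagOf p.1 p.2 * (lowerBidiagOf p.1 p.2)ᵀ))
    ((Measure.pi fun j : Fin k => chiMeasure (2 * a - β * (j:ℕ))).prod
      (Measure.pi fun j : Fin (k-1) => chiMeasure (β * ((k:ℝ) - 1 - (j:ℕ)))))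

/-- Law of the limiting lower bidiagonal Gaussian matrix `Z` (Laguerre case):
i.i.d. `N(0,1)` diagonal and subdiagonal entries. -/
def zBidLaw (k : ℕ) : Measure (Matrix (Fin k) (Fin k) ℝ) :=
  Measure.map (fun p : (Fin k → ℝ) × (Fin (k-1) → ℝ) => lowerBidiagOf p.1 p.2)
    ((Measure.pi fun _ : Fin k => gaussianReal 0 1).prod
      (Measure.pi fun _ : Fin (k-1) => gaussianReal 0 1))

/-- `ν` is the centered `k`-variate Gaussian distribution with covariance matrix `S`:
every linear functional has the corresponding one-dimensional centered Gaussian law. -/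
def IsCenteredGaussianVec {k : ℕ} (ν : Measure (Fin k → ℝ)) (S : Fin k → Fin k → ℝ) : Prop :=
  IsProbabilityMeasure ν ∧ ∀ c : Fin k → ℝ,
    Measure.map (fun x => ∑ i, c i * x i) ν =
      gaussianReal 0 (∑ i, ∑ j, c i * c j * S i j).toNNReal

/-- The density of the chi distribution with parameter `r`. -/
def chiPDFReal (r : ℝ) : ℝ → ℝ :=
  Set.indicator (Set.Ioi (0:ℝ))
    (fun x => (2:ℝ) ^ (1 - r / 2) * x ^ (r - 1) * Real.exp (-x ^ 2 / 2) / Real.Gamma (r / 2))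

/-- The density of `X_r - √r` with `X_r` chi distributed, normalized to take the value `1`
at the origin. -/
def chiKernel (r : ℝ) : ℝ → ℝ :=
  Set.indicator (Set.Ioi (-√r))
    (fun y => Real.exp ((r - 1) * Real.log (1 + y / √r) - √r * y - y ^ 2 / 2))

theorem measurable_chiPDFReal (r : ℝ) : Measurable (chiPDFReal r) :=
  Measurable.indicator (by fun_prop) measurableSet_Ioi

theorem measurable_chiKernel (r : ℝ) : Measurable (chiKernel r) :=
  Measurable.indicator (by fun_prop) measurableSet_Ioi

theorem chiPDFReal_nonneg {r : ℝ} (hr : 0 < r) (x : ℝ) : 0 ≤ chiPDFReal r x := by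
  refine Set.indicator_nonneg (fun x hx => ?_) x
  have hx : 0 < x := hx
  have := Real.Gamma_pos_of_pos (half_pos hr)
  positivity

theorem integral_chiPDFReal {r : ℝ} (hr : 0 < r) : ∫ x, chiPDFReal r x = 1 := by
  have hΓ := Real.Gamma_pos_of_pos (half_pos hr)
  have hI := integral_rpow_mul_exp_neg_mul_rpow (p := 2) (q := r - 1) (b := 1 / 2)
    (by norm_num) (by linarith) (by norm_num)
  calc ∫ x, chiPDFReal r x
      = ∫ x in Set.Ioi (0:ℝ), (2:ℝ) ^ (1 - r / 2) / Real.Gamma (r / 2) *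
          (x ^ (r - 1) * Real.exp (-(1 / 2) * x ^ (2:ℝ))) := by
        rw [chiPDFReal, integral_indicator measurableSet_Ioi]
        congr 1 with x
        rw [Real.rpow_two, show -(1 / 2) * x ^ 2 = -x ^ 2 / 2 by ring]
        ring
    _ = 1 := by
        rw [integral_const_mul, hI, sub_add_cancel, one_div, Real.inv_rpow zero_le_two,
          ← Real.rpow_neg zero_le_two, neg_div, neg_neg, Real.rpow_sub two_pos, Real.rpow_one]
        have : (0:ℝ) < 2 ^ (r / 2) := by positivity
        field_simp

theorem integral_map_sub_sqrt_chiMeasure {r : ℝ} (hr : 0 < r) {f : ℝ → ℝ} (hf : Continuous f) :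
    ∫ x, f x ∂(Measure.map (fun y => y - √r) (chiMeasure r)) =
      ∫ y, chiPDFReal r (y + √r) * f y := by
  rw [integral_map (by fun_prop) hf.aestronglyMeasurable]
  have h : chiMeasure r = volume.withDensity fun x => ENNReal.ofReal (chiPDFReal r x) := rfl
  rw [h, integral_withDensity_eq_integral_toReal_smul (measurable_chiPDFReal r).ennreal_ofReal
    (ae_of_all _ fun _ => ENNReal.ofReal_lt_top),
    ← integral_add_right_eq_self _ (√r)]
  congr 1 with y
  rw [ENNReal.toReal_ofReal (chiPDFReal_nonneg hr _), add_sub_cancel_right, smul_eq_mul]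

theorem exists_chiPDFReal_add_sqrt_eq {r : ℝ} (hr : 0 < r) :
    ∃ K : ℝ, ∀ y, chiPDFReal r (y + √r) = K * chiKernel r y := by
  refine ⟨(2:ℝ) ^ (1 - r / 2) * √r ^ (r - 1) * Real.exp (-r / 2) / Real.Gamma (r / 2),
    fun y => ?_⟩
  have hs : 0 < √r := Real.sqrt_pos.2 hr
  by_cases hy : -√r < y
  · have hu : 0 < 1 + y / √r := by
      rw [show 1 + y / √r = (y + √r) / √r by field_simp; ring]
      exact div_pos (by linarith) hs
    rw [chiPDFReal, chiKernel, Set.indicator_of_mem (by simp only [Set.mem_Ioi]; linarith),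
      Set.indicator_of_mem (by exact hy),
      show y + √r = √r * (1 + y / √r) by field_simp; ring, Real.mul_rpow hs.le hu.le,
      Real.rpow_def_of_pos hu]
    have hexp : Real.exp (Real.log (1 + y / √r) * (r - 1)) *
        Real.exp (-(√r * (1 + y / √r)) ^ 2 / 2) = Real.exp (-r / 2) *
        Real.exp ((r - 1) * Real.log (1 + y / √r) - √r * y - y ^ 2 / 2) := by
      rw [← Real.exp_add, ← Real.exp_add]
      congr 1
      rw [show √r * (1 + y / √r) = √r + y by field_simp]
      linear_combination (-1 / 2) * Real.sq_sqrt hr.le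
    linear_combination (2 ^ (1 - r / 2) * √r ^ (r - 1) / Real.Gamma (r / 2)) * hexp
  · rw [chiPDFReal, chiKernel, Set.indicator_of_notMem (by simp only [Set.mem_Ioi]; linarith),
      Set.indicator_of_notMem (by exact hy), mul_zero]

theorem integral_map_sub_sqrt_chiMeasure_eq_div {r : ℝ} (hr : 0 < r) {f : ℝ → ℝ}
    (hf : Continuous f) :
    ∫ x, f x ∂(Measure.map (fun y => y - √r) (chiMeasure r)) =
      (∫ y, chiKernel r y * f y) / ∫ y, chiKernel r y := by
  obtain ⟨K, hK⟩ := exists_chiPDFReal_add_sqrt_eq hr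
  have h1 : K * ∫ y, chiKernel r y = 1 := by
    rw [← integral_const_mul, ← integral_chiPDFReal hr,
      ← integral_add_right_eq_self (chiPDFReal r) (√r)]
    simp only [hK]
  rw [integral_map_sub_sqrt_chiMeasure hr hf, eq_div_iff (right_ne_zero_of_mul_eq_one h1)]
  simp only [hK, mul_assoc]
  rw [integral_const_mul]
  linear_combination (∫ y, chiKernel r y * f y) * h1

theorem chiKernel_nonneg (r y : ℝ) : 0 ≤ chiKernel r y :=
  Set.indicator_nonneg (fun _ _ => (Real.exp_pos _).le) y

theorem chiKernel_le {r : ℝ} (hr : 1 ≤ r) (y : ℝ) :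
    chiKernel r y ≤ Real.exp 1 * Real.exp (-(1 / 2) * y ^ 2) := by
  refine Set.indicator_apply_le' (fun hy => ?_) (fun _ => by positivity)
  have hy : -√r < y := hy
  have hs : 0 < √r := Real.sqrt_pos.2 (by linarith)
  rw [← Real.exp_add, Real.exp_le_exp]
  have hu : -1 < y / √r := by rw [lt_div_iff₀ hs]; linarith
  have hlog : Real.log (1 + y / √r) ≤ y / √r := by
    linarith [Real.log_le_sub_one_of_pos (show 0 < 1 + y / √r by linarith)]
  have hry : r * (y / √r) = √r * y := by
    field_simp
    rw [Real.sq_sqrt (by linarith), mul_comm]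
  nlinarith [mul_le_mul_of_nonneg_left hlog (sub_nonneg.2 hr)]

theorem abs_log_one_add_sub_le {u : ℝ} (hu : |u| ≤ 1 / 2) :
    |Real.log (1 + u) - u + u ^ 2 / 2| ≤ 2 * |u| ^ 3 := by
  have h := Real.abs_log_sub_add_sum_range_le (x := -u) (by rw [abs_neg]; linarith) 2
  rw [abs_neg, sub_neg_eq_add] at h
  calc |Real.log (1 + u) - u + u ^ 2 / 2| ≤ |u| ^ 3 / (1 - |u|) := by
        convert h using 2
        simp [Finset.sum_range_succ]
        ring
    _ ≤ 2 * |u| ^ 3 := by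
        rw [div_le_iff₀ (by linarith)]
        nlinarith [pow_nonneg (abs_nonneg u) 3]

theorem tendsto_chiKernel (y : ℝ) :
    Tendsto (fun r => chiKernel r y) atTop (𝓝 (Real.exp (-y ^ 2))) := by
  have hu : Tendsto (fun r : ℝ => y / √r) atTop (𝓝 0) :=
    Real.tendsto_sqrt_atTop.const_div_atTop y
  have hlog : Tendsto (fun r : ℝ => Real.log (1 + y / √r)) atTop (𝓝 0) := by
    have := (hu.const_add 1).log (by norm_num)
    simpa using this
  have habs : Tendsto (fun r : ℝ => 2 * y ^ 2 * |y / √r|) atTop (𝓝 0) := by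
    simpa using hu.abs.const_mul (2 * y ^ 2)
  have hrem : Tendsto (fun r : ℝ => r * (Real.log (1 + y / √r) - y / √r + (y / √r) ^ 2 / 2))
      atTop (𝓝 0) := by
    refine squeeze_zero_norm' ?_ habs
    have hsmall : ∀ᶠ r : ℝ in atTop, |y / √r| < 1 / 2 := by
      have := hu.abs
      rw [abs_zero] at this
      exact this.eventually_lt_const (by norm_num)
    filter_upwards [hsmall, eventually_gt_atTop 0] with r h hr
    have hy : r * |y / √r| ^ 2 = y ^ 2 := by
      rw [sq_abs, div_pow, Real.sq_sqrt hr.le]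
      field_simp
    rw [Real.norm_eq_abs, abs_mul, abs_of_pos hr]
    calc r * |Real.log (1 + y / √r) - y / √r + (y / √r) ^ 2 / 2|
        ≤ r * (2 * |y / √r| ^ 3) := by gcongr; exact abs_log_one_add_sub_le h.le
      _ = 2 * y ^ 2 * |y / √r| := by rw [← hy]; ring
  have hexp := Real.continuous_exp.continuousAt.tendsto.comp
    ((hrem.sub hlog).add_const (-y ^ 2))
  rw [sub_zero, zero_add] at hexp
  refine hexp.congr' ?_
  filter_upwards [Real.tendsto_sqrt_atTop.eventually_gt_atTop (-y), eventually_gt_atTop 0]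
    with r h hr
  have hs : 0 < √r := Real.sqrt_pos.2 hr
  rw [chiKernel, Set.indicator_of_mem (by simp only [Set.mem_Ioi]; linarith)]
  simp only [Function.comp_apply]
  congr 1
  have h1 : r * (y / √r) = √r * y := by
    field_simp
    rw [Real.sq_sqrt hr.le, mul_comm]
  have h2 : r * (y / √r) ^ 2 = y ^ 2 := by
    rw [div_pow, Real.sq_sqrt hr.le]
    field_simp
  linear_combination h2 / 2 - h1

theorem tendsto_integral_chiKernel_mul (f : BoundedContinuousFunction ℝ ℝ) :
    Tendsto (fun r => ∫ y, chiKernel r y * f y) atTop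
      (𝓝 (∫ y, Real.exp (-y ^ 2) * f y)) := by
  refine tendsto_integral_filter_of_dominated_convergence
    (fun y => Real.exp 1 * Real.exp (-(1 / 2) * y ^ 2) * ‖f‖) ?_ ?_ ?_ ?_
  · exact .of_forall fun r =>
      ((measurable_chiKernel r).mul f.continuous.measurable).aestronglyMeasurable
  · filter_upwards [eventually_ge_atTop 1] with r hr
    refine ae_of_all _ fun y => ?_
    rw [norm_mul, Real.norm_of_nonneg (chiKernel_nonneg r y)]
    exact mul_le_mul (chiKernel_le hr y) (f.norm_coe_le_norm y) (norm_nonneg _) (by positivity)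
  · exact ((integrable_exp_neg_mul_sq (by norm_num)).const_mul _).mul_const _
  · exact ae_of_all _ fun y => (tendsto_chiKernel y).mul_const _

theorem integral_exp_neg_sq : ∫ y : ℝ, Real.exp (-y ^ 2) = √Real.pi := by
  simpa using integral_gaussian 1

theorem integral_gaussianReal_zero_half (f : ℝ → ℝ) :
    ∫ x, f x ∂(gaussianReal 0 (1 / 2)) =
      (∫ y, Real.exp (-y ^ 2) * f y) / ∫ y : ℝ, Real.exp (-y ^ 2) := by
  rw [integral_gaussianReal_eq_integral_smul (by norm_num), integral_exp_neg_sq,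
    div_eq_inv_mul (∫ y, Real.exp (-y ^ 2) * f y), ← integral_const_mul]
  congr 1 with y
  have h : (2:ℝ) * ((1 / 2 : NNReal) : ℝ) = 1 := by norm_num
  rw [gaussianPDFReal, mul_right_comm, h, one_mul, div_one, sub_zero, smul_eq_mul, mul_assoc]

theorem chi_shifted_tendsto_gaussian :
    ∀ f : BoundedContinuousFunction ℝ ℝ,
      Tendsto (fun r : ℝ => ∫ x, f x ∂(Measure.map (fun y => y - Real.sqrt r) (chiMeasure r)))
        atTop (𝓝 (∫ x, f x ∂(gaussianReal 0 (1/2)))) := by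
  intro f
  rw [integral_gaussianReal_zero_half]
  have hden := tendsto_integral_chiKernel_mul 1
  simp only [BoundedContinuousFunction.coe_one, Pi.one_apply, mul_one] at hden
  have hne : ∫ y : ℝ, Real.exp (-y ^ 2) ≠ 0 := by
    rw [integral_exp_neg_sq]
    positivity
  refine ((tendsto_integral_chiKernel_mul f).div hden hne).congr' ?_
  filter_upwards [eventually_gt_atTop 0] with r hr
  exact (integral_map_sub_sqrt_chiMeasure_eq_div hr f.continuous).symm

end
end

section
/- As β → ∞, the random symmetric tridiagonal matrix √(2kβ)·A_β − √β·H converges in distribution (entrywise, jointly) to the random matrix Z, where Z is the k×k symmetric tridiagonal matrix whose diagonal entries are i.i.d. N(0,1) and whose off-diagonal entries are i.i.d. N(0,1/4), all mutually independent subject to symmetry. -/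
open MeasureTheory ProbabilityTheory Filter Polynomial Matrix Topology Asymptotics

noncomputable section

lemma lintegral_chi_density {r : ℝ} (hr : 0 < r) :
    ∫⁻ x, ENNReal.ofReal
      (Set.indicator (Set.Ioi (0:ℝ))
        (fun x => (2:ℝ) ^ (1 - r / 2) * x ^ (r - 1) * Real.exp (-x ^ 2 / 2) / Real.Gamma (r / 2)) x)
      = 1 := by
  have hΓ : 0 < Real.Gamma (r / 2) := Real.Gamma_pos_of_pos (by positivity)
  have key := integral_rpow_mul_exp_neg_mul_rpow (p := 2) (q := r - 1) (b := 1 / 2)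
    (by norm_num) (by linarith) (by norm_num)
  have hint : IntegrableOn (fun x : ℝ => x ^ (r - 1) * Real.exp (-(1 / 2) * x ^ (2:ℝ)))
      (Set.Ioi 0) :=
    integrableOn_rpow_mul_exp_neg_mul_rpow (by linarith) (by norm_num) (by norm_num)
  have hfun : ∀ x : ℝ, (2:ℝ) ^ (1 - r / 2) * x ^ (r - 1) * Real.exp (-x ^ 2 / 2) / Real.Gamma (r / 2)
      = (2:ℝ) ^ (1 - r / 2) / Real.Gamma (r / 2)
        * (x ^ (r - 1) * Real.exp (-(1 / 2) * x ^ (2:ℝ))) := fun x => by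
    rw [Real.rpow_two, show -x ^ 2 / 2 = -(1 / 2) * x ^ 2 by ring]; ring
  simp_rw [hfun]
  rw [← ofReal_integral_eq_lintegral_ofReal, integral_indicator measurableSet_Ioi,
    integral_const_mul, key]
  · rw [show (r - 1 + 1) / 2 = r / 2 by ring, show -(r - 1 + 1) / 2 = -(r / 2) by ring,
      one_div, Real.inv_rpow (by norm_num), Real.rpow_neg (by norm_num), inv_inv,
      Real.rpow_sub (by norm_num), Real.rpow_one]
    have : (2:ℝ) ^ (r / 2) ≠ 0 := by positivity
    rw [ENNReal.ofReal_eq_one]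
    field_simp
  · rw [integrable_indicator_iff measurableSet_Ioi]
    exact hint.const_mul _
  · refine Eventually.of_forall fun x => Set.indicator_nonneg (fun x hx => ?_) x
    have : (0:ℝ) < x := hx
    positivity

lemma isProbabilityMeasure_chiMeasure {r : ℝ} (hr : 0 < r) :
    IsProbabilityMeasure (chiMeasure r) :=
  ⟨by rw [chiMeasure, withDensity_apply _ MeasurableSet.univ, Measure.restrict_univ,
    lintegral_chi_density hr]⟩

/-- The density of `χ_{s²}` recentred at `s`, up to a factor depending only on `s`. -/
def chiShape (s y : ℝ) : ℝ :=
  Set.indicator (Set.Ioi (-s))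
    (fun y => (1 + y / s) ^ (s ^ 2 - 1) * Real.exp (-(s * y) - y ^ 2 / 2)) y

lemma measurable_chiShape (s : ℝ) : Measurable (chiShape s) := by
  unfold chiShape
  refine Measurable.indicator ?_ measurableSet_Ioi
  fun_prop

lemma one_add_div_pos {s y : ℝ} (hs : 0 < s) (hy : -s < y) : 0 < 1 + y / s := by
  have : 1 + y / s = (s + y) / s := by field_simp
  rw [this]
  exact div_pos (by linarith) hs

lemma chiShape_nonneg {s : ℝ} (hs : 0 < s) (y : ℝ) : 0 ≤ chiShape s y := by
  refine Set.indicator_nonneg (fun y hy => ?_) y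
  have := one_add_div_pos hs hy
  positivity

lemma chiShape_le {s : ℝ} (hs : 1 ≤ s) (y : ℝ) :
    chiShape s y ≤ Real.exp (|y| - y ^ 2 / 2) := by
  have hs0 : 0 < s := by linarith
  refine Set.indicator_le' (g := fun y : ℝ => Real.exp (|y| - y ^ 2 / 2)) (fun y hy => ?_)
    (fun _ _ => (Real.exp_pos _).le) y
  have hpos := one_add_div_pos hs0 hy
  rw [Real.rpow_def_of_pos hpos, ← Real.exp_add]
  refine Real.exp_le_exp.2 ?_
  have h1 : Real.log (1 + y / s) ≤ y / s := by
    have := Real.log_le_sub_one_of_pos hpos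
    linarith
  have h2 : Real.log (1 + y / s) * (s ^ 2 - 1) ≤ y / s * (s ^ 2 - 1) :=
    mul_le_mul_of_nonneg_right h1 (by nlinarith)
  have h3 : y / s * (s ^ 2 - 1) = s * y - y / s := by field_simp
  have h4 : -(y / s) ≤ |y| := by
    calc -(y / s) ≤ |y / s| := neg_le_abs _
      _ = |y| / s := by rw [abs_div, abs_of_pos hs0]
      _ ≤ |y| := div_le_self (abs_nonneg _) hs
  linarith

lemma tendsto_sq_mul_log_one_add_div (y : ℝ) :
    Tendsto (fun s : ℝ => s ^ 2 * Real.log (1 + y / s) - s * y) atTop (𝓝 (-(y ^ 2 / 2))) := by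
  rw [tendsto_iff_norm_sub_tendsto_zero]
  have h0 : Tendsto (fun s : ℝ => |y| / s) atTop (𝓝 0) := tendsto_const_nhds.div_atTop tendsto_id
  have hlim : Tendsto (fun s : ℝ => |y| ^ 2 * (|y| / s) / (1 - |y| / s)) atTop (𝓝 0) := by
    have := (h0.const_mul (|y| ^ 2)).div (h0.const_sub 1) (by norm_num)
    rwa [mul_zero, zero_div] at this
  refine squeeze_zero' (Eventually.of_forall fun _ => norm_nonneg _) ?_ hlim
  filter_upwards [eventually_gt_atTop 0, eventually_gt_atTop |y|] with s hs hsy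
  have hx : |-(y / s)| < 1 := by
    rw [abs_neg, abs_div, abs_of_pos hs, div_lt_one hs]
    exact hsy
  have h := Real.abs_log_sub_add_sum_range_le hx 2
  rw [abs_neg, abs_div, abs_of_pos hs] at h
  simp only [Finset.sum_range_succ, Finset.sum_range_zero] at h
  have heq : s ^ 2 * Real.log (1 + y / s) - s * y - -(y ^ 2 / 2)
      = s ^ 2 * (0 + (-(y / s)) ^ (0 + 1) / ((0:ℕ) + 1) + (-(y / s)) ^ (1 + 1) / ((1:ℕ) + 1)
        + Real.log (1 - -(y / s))) := by
    rw [sub_neg_eq_add 1]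
    push_cast
    field_simp
    ring
  rw [heq, Real.norm_eq_abs, abs_mul, abs_of_pos (by positivity : 0 < s ^ 2)]
  calc _ ≤ s ^ 2 * ((|y| / s) ^ (2 + 1) / (1 - |y| / s)) := by gcongr
    _ = _ := by
      have : s ^ 2 * (|y| / s) ^ (2 + 1) = |y| ^ 2 * (|y| / s) := by
        rw [div_pow]; field_simp
      rw [← mul_div_assoc, this]

lemma tendsto_chiShape (y : ℝ) :
    Tendsto (fun s => chiShape s y) atTop (𝓝 (Real.exp (-y ^ 2))) := by
  have hlog : Tendsto (fun s : ℝ => Real.log (1 + y / s)) atTop (𝓝 0) := by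
    have h0 : Tendsto (fun s : ℝ => 1 + y / s) atTop (𝓝 (1 + 0)) :=
      (tendsto_const_nhds.div_atTop tendsto_id).const_add 1
    rw [add_zero] at h0
    simpa using h0.log one_ne_zero
  have h := (((tendsto_sq_mul_log_one_add_div y).sub hlog).sub_const (y ^ 2 / 2)).rexp
  rw [show -(y ^ 2 / 2) - 0 - y ^ 2 / 2 = -y ^ 2 by ring] at h
  refine h.congr' ?_
  filter_upwards [eventually_gt_atTop 0, eventually_gt_atTop (-y)] with s hs hsy
  have hy : -s < y := by linarith
  rw [chiShape, Set.indicator_of_mem (Set.mem_Ioi.2 hy),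
    Real.rpow_def_of_pos (one_add_div_pos hs hy), ← Real.exp_add]
  congr 1
  ring

lemma integrable_exp_abs_sub_sq : Integrable fun y : ℝ => Real.exp (|y| - y ^ 2 / 2) := by
  have hg : Integrable fun y : ℝ => Real.exp 1 * Real.exp (-(1 / 4) * y ^ 2) :=
    (integrable_exp_neg_mul_sq (by norm_num)).const_mul _
  refine hg.mono' (by fun_prop) (Eventually.of_forall fun y => ?_)
  rw [Real.norm_eq_abs, abs_of_pos (Real.exp_pos _), ← Real.exp_add]
  refine Real.exp_le_exp.2 ?_
  nlinarith [sq_nonneg (|y| - 2), sq_abs y]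

lemma tendsto_integral_chiShape_mul (φ : BoundedContinuousFunction ℝ ℝ) :
    Tendsto (fun s => ∫ y, chiShape s y * φ y) atTop (𝓝 (∫ y, Real.exp (-y ^ 2) * φ y)) := by
  refine tendsto_integral_filter_of_dominated_convergence
    (fun y => Real.exp (|y| - y ^ 2 / 2) * ‖φ‖) ?_ ?_ (integrable_exp_abs_sub_sq.mul_const _) ?_
  · exact Eventually.of_forall fun s =>
      ((measurable_chiShape s).mul φ.continuous.measurable).aestronglyMeasurable
  · filter_upwards [eventually_ge_atTop 1] with s hs
    refine Eventually.of_forall fun y => ?_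
    rw [norm_mul, Real.norm_of_nonneg (chiShape_nonneg (by linarith) y)]
    exact mul_le_mul (chiShape_le hs y) (φ.norm_coe_le_norm y) (norm_nonneg _) (Real.exp_pos _).le
  · exact Eventually.of_forall fun y => (tendsto_chiShape y).mul_const _

lemma integral_chiMeasure_shift {s : ℝ} (hs : 0 < s) (φ : ℝ → ℝ) :
    ∫ x, φ (x - s) ∂(chiMeasure (s ^ 2))
      = (2:ℝ) ^ (1 - s ^ 2 / 2) / Real.Gamma (s ^ 2 / 2) * s ^ (s ^ 2 - 1) * Real.exp (-s ^ 2 / 2)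
        * ∫ y, chiShape s y * φ y := by
  have hΓ : 0 < Real.Gamma (s ^ 2 / 2) := Real.Gamma_pos_of_pos (by positivity)
  rw [chiMeasure, integral_withDensity_eq_integral_toReal_smul₀,
    ← integral_add_right_eq_self _ s, ← integral_const_mul]
  · congr 1
    ext y
    rw [add_sub_cancel_right, smul_eq_mul, ← mul_assoc]
    congr 1
    by_cases hy : -s < y
    · have h1 : 0 < y + s := by linarith
      have h2 := one_add_div_pos hs hy
      rw [chiShape, Set.indicator_of_mem (Set.mem_Ioi.2 hy),
        Set.indicator_of_mem (Set.mem_Ioi.2 h1), ENNReal.toReal_ofReal (by positivity)]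
      have h3 : y + s = s * (1 + y / s) := by field_simp; ring
      have h4 : Real.exp (-(y + s) ^ 2 / 2)
          = Real.exp (-s ^ 2 / 2) * Real.exp (-(s * y) - y ^ 2 / 2) := by
        rw [← Real.exp_add]; congr 1; ring
      rw [h4, h3, Real.mul_rpow hs.le h2.le]
      ring
    · have h1 : ¬ 0 < y + s := by linarith
      rw [chiShape, Set.indicator_of_notMem (show y + s ∉ Set.Ioi 0 from h1),
        Set.indicator_of_notMem (show y ∉ Set.Ioi (-s) from hy)]
      simp
  · refine (ENNReal.measurable_ofReal.comp (Measurable.indicator ?_ measurableSet_Ioi)).aemeasurable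
    fun_prop
  · exact Eventually.of_forall fun _ => ENNReal.ofReal_lt_top

lemma integral_gaussianReal_half (φ : ℝ → ℝ) :
    ∫ y, φ y ∂(gaussianReal 0 (1 / 2))
      = (∫ y, Real.exp (-y ^ 2) * φ y) / ∫ y : ℝ, Real.exp (-y ^ 2) := by
  have hG : ∫ y : ℝ, Real.exp (-y ^ 2) = Real.sqrt Real.pi := by
    simpa using integral_gaussian 1
  rw [hG, integral_gaussianReal_eq_integral_smul (by norm_num), div_eq_inv_mul _ (Real.sqrt _),
    ← integral_const_mul]
  congr 1
  ext y
  simp only [gaussianPDFReal, smul_eq_mul]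
  have hv : (((1 / 2 : NNReal)) : ℝ) = 1 / 2 := by push_cast; rfl
  rw [hv, mul_assoc, show 2 * Real.pi * (1 / 2) = Real.pi by ring,
    show -(y - 0) ^ 2 / (2 * (1 / 2)) = -y ^ 2 by ring]

lemma tendsto_integral_chiMeasure_shift (φ : BoundedContinuousFunction ℝ ℝ) :
    Tendsto (fun s => ∫ x, φ (x - s) ∂(chiMeasure (s ^ 2))) atTop
      (𝓝 (∫ y, φ y ∂(gaussianReal 0 (1 / 2)))) := by
  rw [integral_gaussianReal_half]
  have h1 := tendsto_integral_chiShape_mul (BoundedContinuousFunction.const ℝ 1)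
  simp only [BoundedContinuousFunction.const_apply, mul_one] at h1
  have hpos : (∫ y : ℝ, Real.exp (-y ^ 2)) ≠ 0 := by
    have hG : ∫ y : ℝ, Real.exp (-y ^ 2) = Real.sqrt Real.pi := by
      simpa using integral_gaussian 1
    rw [hG]; positivity
  refine ((tendsto_integral_chiShape_mul φ).div h1 hpos).congr' ?_
  filter_upwards [eventually_gt_atTop 0] with s hs
  have := isProbabilityMeasure_chiMeasure (r := s ^ 2) (by positivity)
  have hone := integral_chiMeasure_shift hs fun _ => 1
  simp only [integral_const, probReal_univ, smul_eq_mul, mul_one] at hone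
  have hne : (∫ y, chiShape s y) ≠ 0 := fun h => by simp [h] at hone
  rw [integral_chiMeasure_shift hs, Pi.div_apply, div_eq_iff hne, mul_right_comm, ← hone, one_mul]

/-- The law of `(X - √r) / √2` with `X ∼ χ_r`; a Dirac mass in the degenerate case `r ≤ 0`. -/
def chiFluct (r : ℝ) : ProbabilityMeasure ℝ :=
  if hr : 0 < r then
    ⟨Measure.map (fun x => (x - Real.sqrt r) / Real.sqrt 2) (chiMeasure r),
      have := isProbabilityMeasure_chiMeasure hr
      Measure.isProbabilityMeasure_map (by fun_prop)⟩
  else ⟨Measure.dirac 0, inferInstance⟩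

lemma coe_chiFluct {r : ℝ} (hr : 0 < r) :
    (chiFluct r : Measure ℝ)
      = Measure.map (fun x => (x - Real.sqrt r) / Real.sqrt 2) (chiMeasure r) :=
  congrArg (fun P : ProbabilityMeasure ℝ => (P : Measure ℝ)) (dif_pos hr)

/-- The centred real Gaussian law of variance `v`, as a bundled probability measure. -/
def centredGaussian (v : NNReal) : ProbabilityMeasure ℝ := ⟨gaussianReal 0 v, inferInstance⟩

lemma coe_centredGaussian (v : NNReal) : (centredGaussian v : Measure ℝ) = gaussianReal 0 v := rfl

lemma gaussianReal_quarter :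
    gaussianReal 0 (1 / 4) = Measure.map (fun x => x / Real.sqrt 2) (gaussianReal 0 (1 / 2)) := by
  rw [gaussianReal_map_div_const]
  congr 1
  · simp
  · ext
    push_cast
    simp
    norm_num

lemma tendsto_chiFluct :
    Tendsto chiFluct atTop (𝓝 (centredGaussian (1 / 4))) := by
  rw [ProbabilityMeasure.tendsto_iff_forall_integral_tendsto]
  intro f
  have hcont : Continuous fun x : ℝ => x / Real.sqrt 2 := by fun_prop
  have h := (tendsto_integral_chiMeasure_shift (f.compContinuous ⟨_, hcont⟩)).comp
    Real.tendsto_sqrt_atTop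
  simp only [BoundedContinuousFunction.compContinuous_apply, ContinuousMap.coe_mk] at h
  rw [coe_centredGaussian, gaussianReal_quarter,
    integral_map (by fun_prop) f.continuous.aestronglyMeasurable]
  refine h.congr' ?_
  filter_upwards [eventually_gt_atTop 0] with r hr
  rw [coe_chiFluct hr, integral_map (by fun_prop) f.continuous.aestronglyMeasurable]
  simp only [Function.comp_apply, Real.sq_sqrt hr.le]

lemma continuous_symTridiagOf {k : ℕ} :
    Continuous fun p : (Fin k → ℝ) × (Fin (k - 1) → ℝ) => symTridiagOf p.1 p.2 := by
  refine continuous_matrix fun i j => ?_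
  simp only [symTridiagOf, Matrix.of_apply]
  split_ifs <;> fun_prop

instance instBorelSpaceMatrix {m n : Type*} [Countable m] [Countable n] :
    BorelSpace (Matrix m n ℝ) :=
  inferInstanceAs (BorelSpace (m → n → ℝ))

lemma symTridiagOf_sub_smul_hermiteH {k : ℕ} (b : ℝ) (d : Fin k → ℝ) (e : Fin (k - 1) → ℝ) :
    symTridiagOf d e - b • hermiteH k = symTridiagOf d
      fun j => e j - b * (Real.sqrt ((k:ℝ) - 1 - (j:ℕ)) / Real.sqrt 2) := by
  ext i j
  simp only [hermiteH, symTridiagOf, Matrix.sub_apply, Matrix.smul_apply, Matrix.of_apply,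
    smul_eq_mul]
  split_ifs <;> simp

lemma map_hermiteLaw {k : ℕ} (hk : 1 ≤ k) {β : ℝ} (hβ : 0 < β) :
    Measure.map (fun A => Real.sqrt (2 * (k:ℝ) * β) • A - Real.sqrt β • hermiteH k)
        (hermiteLaw k β)
      = Measure.map (fun p : (Fin k → ℝ) × (Fin (k - 1) → ℝ) => symTridiagOf p.1 p.2)
        ((Measure.pi fun _ : Fin k => gaussianReal 0 1).prod
          (Measure.pi fun j : Fin (k - 1) =>
            (chiFluct (((k:ℝ) - 1 - (j:ℕ)) * β) : Measure ℝ))) := by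
  have hc : ∀ j : Fin (k - 1), (0:ℝ) < (k:ℝ) - 1 - (j:ℕ) := fun j => by
    have h : (j:ℕ) + 1 < k := by have := j.isLt; omega
    have h' : ((j:ℕ):ℝ) + 1 < k := by exact_mod_cast h
    linarith
  have hcβ : ∀ j : Fin (k - 1), (0:ℝ) < ((k:ℝ) - 1 - (j:ℕ)) * β := fun j => mul_pos (hc j) hβ
  have hprob : ∀ j : Fin (k - 1),
      IsProbabilityMeasure (chiMeasure (((k:ℝ) - 1 - (j:ℕ)) * β)) :=
    fun j => isProbabilityMeasure_chiMeasure (hcβ j)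
  have hprob' : ∀ j : Fin (k - 1), IsProbabilityMeasure (Measure.map (fun x => x / Real.sqrt 2)
      (chiMeasure (((k:ℝ) - 1 - (j:ℕ)) * β))) :=
    fun j => Measure.isProbabilityMeasure_map (by fun_prop)
  set shift : (Fin (k - 1) → ℝ) → Fin (k - 1) → ℝ := fun e j =>
    e j - Real.sqrt β * (Real.sqrt ((k:ℝ) - 1 - (j:ℕ)) / Real.sqrt 2) with hshift
  have hshift_meas : Measurable shift := by fun_prop
  have hpi : (Measure.pi fun j : Fin (k - 1) =>
        (chiFluct (((k:ℝ) - 1 - (j:ℕ)) * β) : Measure ℝ))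
      = Measure.map shift (Measure.pi fun j : Fin (k - 1) =>
        Measure.map (fun x => x / Real.sqrt 2) (chiMeasure (((k:ℝ) - 1 - (j:ℕ)) * β))) := by
    rw [hshift, Measure.pi_map_pi
      (f := fun (j : Fin (k - 1)) (x : ℝ) =>
        x - Real.sqrt β * (Real.sqrt ((k:ℝ) - 1 - (j:ℕ)) / Real.sqrt 2))
      (fun j => by fun_prop)]
    congr 1
    ext1 j
    rw [coe_chiFluct (hcβ j), Measure.map_map (by fun_prop) (by fun_prop)]
    congr 1
    ext x
    rw [Function.comp_apply, Real.sqrt_mul (hc j).le]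
    ring
  have hsymm := (continuous_symTridiagOf (k := k)).measurable
  have hscale : Measurable fun A : Matrix (Fin k) (Fin k) ℝ =>
      Real.sqrt (2 * (k:ℝ) * β) • A - Real.sqrt β • hermiteH k :=
    Continuous.measurable (by fun_prop)
  have hne : Real.sqrt (2 * (k:ℝ) * β) ≠ 0 := by
    have : (0:ℝ) < k := by exact_mod_cast hk
    positivity
  have hscale' : Measurable fun p : (Fin k → ℝ) × (Fin (k - 1) → ℝ) =>
      (Real.sqrt (2 * (k:ℝ) * β))⁻¹ • symTridiagOf p.1 p.2 :=
    (continuous_symTridiagOf.const_smul (Real.sqrt (2 * (k:ℝ) * β))⁻¹).measurable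
  have hgauss : (Measure.pi fun _ : Fin k => gaussianReal 0 1)
      = Measure.map id (Measure.pi fun _ : Fin k => gaussianReal 0 1) := Measure.map_id.symm
  rw [hermiteLaw, Measure.map_map hscale hscale', hpi, hgauss,
    Measure.map_prod_map _ _ measurable_id hshift_meas,
    Measure.map_map hsymm (measurable_id.prodMap hshift_meas), ← hgauss]
  congr 1
  ext1 p
  simp only [Function.comp_apply, smul_smul, mul_inv_cancel₀ hne, one_smul,
    symTridiagOf_sub_smul_hermiteH, Prod.map_fst, Prod.map_snd, id_eq, hshift]

lemma tendsto_gaussian_prod_chiFluct (k : ℕ) :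
    Tendsto (fun β : ℝ =>
        (ProbabilityMeasure.pi fun _ : Fin k => centredGaussian 1).prod
        (ProbabilityMeasure.pi fun j : Fin (k - 1) => chiFluct (((k:ℝ) - 1 - (j:ℕ)) * β)))
      atTop (𝓝 ((ProbabilityMeasure.pi fun _ : Fin k => centredGaussian 1).prod
        (ProbabilityMeasure.pi fun _ : Fin (k - 1) => centredGaussian (1 / 4)))) := by
  have hpi : Tendsto (fun (β : ℝ) (j : Fin (k - 1)) => chiFluct (((k:ℝ) - 1 - (j:ℕ)) * β)) atTop
      (𝓝 fun _ => centredGaussian (1 / 4)) := by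
    refine tendsto_pi_nhds.2 fun j => tendsto_chiFluct.comp (tendsto_id.const_mul_atTop ?_)
    have h : (j:ℕ) + 1 < k := by have := j.isLt; omega
    have h' : ((j:ℕ):ℝ) + 1 < k := by exact_mod_cast h
    linarith
  have h := (ProbabilityMeasure.continuous_pi.tendsto _).comp hpi
  exact (ProbabilityMeasure.continuous_prod.tendsto _).comp (tendsto_const_nhds.prodMk_nhds h)

theorem hermite_matrix_fluctuation (k : ℕ) (hk : 1 ≤ k) :
    ∀ f : BoundedContinuousFunction (Matrix (Fin k) (Fin k) ℝ) ℝ,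
      Tendsto (fun β : ℝ => ∫ M, f M ∂(Measure.map
          (fun A => Real.sqrt (2 * (k:ℝ) * β) • A - Real.sqrt β • hermiteH k)
          (hermiteLaw k β)))
        atTop (𝓝 (∫ M, f M ∂(zLaw k))) := by
  intro f
  have h := ProbabilityMeasure.tendsto_iff_forall_integral_tendsto.1
    (tendsto_gaussian_prod_chiFluct k) (f.compContinuous ⟨_, continuous_symTridiagOf⟩)
  rw [zLaw, integral_map continuous_symTridiagOf.aemeasurable f.continuous.aestronglyMeasurable]
  refine h.congr' ?_
  filter_upwards [eventually_gt_atTop 0] with β hβ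
  rw [map_hermiteLaw hk hβ, integral_map continuous_symTridiagOf.aemeasurable
    f.continuous.aestronglyMeasurable]
  rfl

end
end

section
/- Let l be a root of the k-th Laguerre polynomial L_k^{γ−1} of parameter γ−1. Then the vector w ∈ ℝ^k with components w_j = L_{k−j}^γ(l) for j = 1,…,k (i.e. w = (L_{k−1}^γ(l), L_{k−2}^γ(l), …, L_1^γ(l), L_0^γ(l))^T) is a nonzero eigenvector of the matrix L_γ with eigenvalue l: L_γ·w = l·w. Consequently, the eigenvalues of L_γ are exactly the k roots of L_k^{γ−1}. -/
open MeasureTheory ProbabilityTheory Filter Polynomial Matrix Topology Asymptotics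

noncomputable section

/-- The three-term recurrence; at `n = 0` the coefficient of `Lag γ (n - 1)` vanishes. -/
theorem Lag_recurrence {γ : ℝ} (hγ : -1 < γ) (n : ℕ) (x : ℝ) :
    √((n : ℝ) + 1) * √((n : ℝ) + 1 + γ) * Lag γ (n + 1) x =
      (x - (2 * (n : ℝ) + γ + 1)) * Lag γ n x - √(n : ℝ) * √((n : ℝ) + γ) * Lag γ (n - 1) x := by
  cases n with
  | zero =>
    have h : √(γ + 1) ≠ 0 := (Real.sqrt_pos.2 (by linarith)).ne'
    simp only [Lag, Nat.cast_zero, zero_add, Real.sqrt_zero, Real.sqrt_one, add_comm 1 γ]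
    field_simp
    ring
  | succ n =>
    have hn : (0 : ℝ) ≤ n := n.cast_nonneg
    have h : √(((n : ℝ) + 2) * (((n : ℝ) + 2) + γ)) ≠ 0 :=
      (Real.sqrt_pos.2 (mul_pos (by linarith) (by linarith))).ne'
    have e : (n : ℝ) + 1 + 1 = n + 2 := by ring
    rw [show n + 1 + 1 = n + 2 from rfl, Nat.add_sub_cancel]
    push_cast
    rw [e, ← Real.sqrt_mul (by linarith), ← Real.sqrt_mul (by linarith), Lag,
      mul_div_cancel₀ _ h]

/-- Lowering the parameter: `L_n^{γ-1} = √(n+γ) L_n^γ + √n L_{n-1}^γ`. -/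
theorem Lag_sub_one {γ : ℝ} (hγ : 0 < γ) (n : ℕ) (x : ℝ) :
    Lag (γ - 1) n x = √((n : ℝ) + γ) * Lag γ n x + √(n : ℝ) * Lag γ (n - 1) x := by
  induction n using Nat.strong_induction_on with
  | _ n ih =>
    cases n with
    | zero =>
      simp only [Lag, Nat.cast_zero, zero_add, Real.sqrt_zero, zero_mul, add_zero, sub_add_cancel]
      rw [Real.Gamma_add_one hγ.ne', Real.mul_rpow hγ.le (Real.Gamma_pos_of_pos hγ).le,
        Real.sqrt_eq_rpow, ← mul_assoc, ← Real.rpow_add hγ]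
      norm_num
    | succ n =>
      have hn : (0 : ℝ) ≤ n := n.cast_nonneg
      have hM := Lag_recurrence (γ := γ - 1) (by linarith) n x
      have hP := Lag_recurrence (γ := γ) (by linarith) n x
      have ha : √((n : ℝ) + 1) ≠ 0 := (Real.sqrt_pos.2 (by linarith)).ne'
      have hb : √((n : ℝ) + γ) ≠ 0 := (Real.sqrt_pos.2 (by linarith)).ne'
      have e : (n : ℝ) + 1 + (γ - 1) = n + γ := by ring
      rw [e, ih n n.lt_succ_self] at hM
      have sa : √((n : ℝ) + 1) ^ 2 = n + 1 := Real.sq_sqrt (by linarith)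
      have sb : √((n : ℝ) + γ) ^ 2 = n + γ := Real.sq_sqrt (by linarith)
      have sn : √(n : ℝ) ^ 2 = n := Real.sq_sqrt hn
      apply mul_left_cancel₀ (mul_ne_zero ha hb)
      rw [hM]
      push_cast
      cases n with
      | zero =>
        simp only [Nat.cast_zero, zero_add, Real.sqrt_zero, Real.sqrt_one] at *
        linear_combination (-√γ) * hP
      | succ m =>
        have hP' := Lag_recurrence (γ := γ) (by linarith) m x
        rw [Nat.add_sub_cancel] at hP ⊢
        rw [ih m (by omega)]
        push_cast at sa sb sn hP ⊢
        have hm : (0 : ℝ) ≤ m := m.cast_nonneg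
        have sc : √((m : ℝ) + γ) ^ 2 = m + γ := Real.sq_sqrt (by linarith)
        rw [show (m : ℝ) + 1 + (γ - 1) = m + γ by ring]
        linear_combination (-√((m : ℝ) + 1 + γ)) * hP - √((m : ℝ) + 1) * hP'
          - √((m : ℝ) + 1 + γ) * Lag γ (m + 1) x * sa + √((m : ℝ) + 1 + γ) * Lag γ (m + 1) x * sn
          + √((m : ℝ) + 1) * Lag γ m x * sb - √((m : ℝ) + 1) * Lag γ m x * sc

/-- Raising the parameter: `x L_n^γ = √(n+1) L_{n+1}^{γ-1} + √(n+γ) L_n^{γ-1}`. -/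
theorem mul_Lag {γ : ℝ} (hγ : 0 < γ) (n : ℕ) (x : ℝ) :
    x * Lag γ n x =
      √((n : ℝ) + 1) * Lag (γ - 1) (n + 1) x + √((n : ℝ) + γ) * Lag (γ - 1) n x := by
  have hn : (0 : ℝ) ≤ n := n.cast_nonneg
  have sa : √((n : ℝ) + 1) ^ 2 = n + 1 := Real.sq_sqrt (by linarith)
  have sb : √((n : ℝ) + γ) ^ 2 = n + γ := Real.sq_sqrt (by linarith)
  have hP := Lag_recurrence (γ := γ) (by linarith) n x
  rw [Lag_sub_one hγ, Lag_sub_one hγ, Nat.add_sub_cancel]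
  push_cast
  linear_combination -hP - Lag γ n x * sa - Lag γ n x * sb

theorem lagB_apply (k : ℕ) (γ : ℝ) (i j : Fin k) :
    lagB k γ i j = (if (i : ℕ) = j then √(γ + (k : ℝ) - 1 - (i : ℕ)) else 0) +
      (if (j : ℕ) + 1 = i then √((k : ℝ) - 1 - (j : ℕ)) else 0) := by
  simp only [lagB, lowerBidiagOf, Matrix.of_apply, Fin.ext_iff]
  split_ifs <;> first | omega | simp

theorem lagB_mulVec_zero {k : ℕ} (γ : ℝ) (U : ℕ → ℝ) (h : 0 < k) :
    (lagB k γ).mulVec (fun j => U j) ⟨0, h⟩ = √(γ + (k : ℝ) - 1) * U 0 := by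
  simp only [Matrix.mulVec, dotProduct, lagB_apply, Nat.succ_ne_zero, if_false, add_zero]
  rw [Fin.sum_univ_eq_sum_range
    (fun j => (if 0 = j then √(γ + (k : ℝ) - 1 - (0 : ℕ)) else 0) * U j)]
  simp [ite_mul, h]

theorem lagB_mulVec_succ {k : ℕ} (γ : ℝ) (U : ℕ → ℝ) (i : ℕ) (h : i + 1 < k) :
    (lagB k γ).mulVec (fun j => U j) ⟨i + 1, h⟩ =
      √(γ + (k : ℝ) - 1 - ((i : ℝ) + 1)) * U (i + 1) + √((k : ℝ) - 1 - i) * U i := by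
  simp only [Matrix.mulVec, dotProduct, lagB_apply, add_left_inj]
  rw [Fin.sum_univ_eq_sum_range
    (fun j => ((if i + 1 = j then √(γ + (k : ℝ) - 1 - (i + 1 : ℕ)) else 0) +
      (if j = i then √((k : ℝ) - 1 - (j : ℕ)) else 0)) * U j)]
  simp [add_mul, ite_mul, Finset.sum_add_distrib, h, (Nat.lt_succ_self i).trans h]

/-- In the last row the coefficient of `U (i + 1)` vanishes. -/
theorem lagB_transpose_mulVec {k : ℕ} (γ : ℝ) (U : ℕ → ℝ) (i : ℕ) (h : i < k) :
    (lagB k γ)ᵀ.mulVec (fun j => U j) ⟨i, h⟩ =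
      √(γ + (k : ℝ) - 1 - i) * U i + √((k : ℝ) - 1 - i) * U (i + 1) := by
  simp only [Matrix.mulVec, dotProduct, Matrix.transpose_apply, lagB_apply]
  rw [Fin.sum_univ_eq_sum_range
    (fun j => ((if j = i then √(γ + (k : ℝ) - 1 - (j : ℕ)) else 0) +
      (if i + 1 = j then √((k : ℝ) - 1 - (i : ℕ)) else 0)) * U j)]
  simp only [add_mul, ite_mul, zero_mul, Finset.sum_add_distrib, Finset.sum_ite_eq,
    Finset.sum_ite_eq', Finset.mem_range, h, if_true]
  split_ifs with h'
  · rfl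
  · have e : k = i + 1 := by omega
    simp [e]

theorem lagB_transpose_mulVec_Lag {k : ℕ} {γ : ℝ} (hγ : 0 < γ) (x : ℝ) :
    (lagB k γ)ᵀ.mulVec (fun j : Fin k => Lag γ (k - 1 - (j : ℕ)) x) =
      fun j : Fin k => Lag (γ - 1) (k - 1 - (j : ℕ)) x := by
  ext ⟨i, h⟩
  rw [lagB_transpose_mulVec γ (fun j => Lag γ (k - 1 - j) x) i h]
  obtain ⟨n, rfl⟩ : ∃ n, k = i + n + 1 := ⟨k - i - 1, by omega⟩
  rw [show i + n + 1 - 1 - i = n by omega, show i + n + 1 - 1 - (i + 1) = n - 1 by omega,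
    Lag_sub_one hγ]
  push_cast
  ring_nf

theorem lagL_mulVec_Lag {k : ℕ} (hk : 0 < k) {γ : ℝ} (hγ : 0 < γ) (x : ℝ) :
    (lagL k γ).mulVec (fun j : Fin k => Lag γ (k - 1 - (j : ℕ)) x) =
      x • (fun j : Fin k => Lag γ (k - 1 - (j : ℕ)) x) -
        Pi.single ⟨0, hk⟩ (√(k : ℝ) * Lag (γ - 1) k x) := by
  rw [lagL, ← Matrix.mulVec_mulVec, lagB_transpose_mulVec_Lag hγ]
  ext ⟨i, h⟩
  cases i with
  | zero =>
    rw [lagB_mulVec_zero γ (fun j => Lag (γ - 1) (k - 1 - j) x) h]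
    obtain ⟨n, rfl⟩ : ∃ n, k = n + 1 := ⟨k - 1, by omega⟩
    simp only [Pi.sub_apply, Pi.smul_apply, smul_eq_mul, Pi.single_eq_same, Nat.add_sub_cancel,
      Nat.sub_zero, mul_Lag hγ]
    push_cast
    ring_nf
  | succ i =>
    rw [lagB_mulVec_succ γ (fun j => Lag (γ - 1) (k - 1 - j) x) i h]
    obtain ⟨n, rfl⟩ : ∃ n, k = i + n + 2 := ⟨k - i - 2, by omega⟩
    simp only [Pi.sub_apply, Pi.smul_apply, smul_eq_mul]
    rw [Pi.single_eq_of_ne (by simp [Fin.ext_iff]), show i + n + 2 - 1 - (i + 1) = n by omega,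
      show i + n + 2 - 1 - i = n + 1 by omega, mul_Lag hγ]
    push_cast
    ring_nf

/-- An eigenvector of `lagL k γ` is determined by its first coordinate. -/
theorem eq_zero_of_lagL_mulVec_eq_smul {k : ℕ} (hk : 0 < k) {γ : ℝ} (hγ : 0 < γ) {x : ℝ}
    {v : Fin k → ℝ} (hv : (lagL k γ).mulVec v = x • v) (h0 : v ⟨0, hk⟩ = 0) : v = 0 := by
  obtain ⟨V, rfl⟩ : ∃ V : ℕ → ℝ, v = fun j : Fin k => V j :=
    ⟨fun i => if h : i < k then v ⟨i, h⟩ else 0, by ext j; simp⟩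
  rw [lagL, ← Matrix.mulVec_mulVec] at hv
  have hT : (lagB k γ)ᵀ.mulVec (fun j : Fin k => V j) = fun i : Fin k =>
      (fun i : ℕ => √(γ + (k : ℝ) - 1 - i) * V i + √((k : ℝ) - 1 - i) * V (i + 1)) i := by
    ext ⟨i, h⟩
    exact lagB_transpose_mulVec γ V i h
  rw [hT] at hv
  clear hT
  set U : ℕ → ℝ := fun i => √(γ + (k : ℝ) - 1 - i) * V i + √((k : ℝ) - 1 - i) * V (i + 1)
  have key : ∀ i, i < k → V i = 0 ∧ U i = 0 := by
    intro i
    induction i with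
    | zero =>
      intro h
      have hd : √(γ + (k : ℝ) - 1) ≠ 0 := by
        have : (1 : ℝ) ≤ k := by exact_mod_cast h
        exact (Real.sqrt_pos.2 (by linarith)).ne'
      have hr := congrFun hv ⟨0, h⟩
      rw [lagB_mulVec_zero γ U h] at hr
      simp only [Pi.smul_apply, smul_eq_mul] at hr h0
      rw [h0, mul_zero] at hr
      exact ⟨h0, (mul_eq_zero.1 hr).resolve_left hd⟩
    | succ i ih =>
      intro h
      obtain ⟨hVi, hUi⟩ := ih (by omega)
      have hki : (i : ℝ) + 1 + 1 ≤ k := by exact_mod_cast h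
      have hV : V (i + 1) = 0 := by
        have hu : √(γ + (k : ℝ) - 1 - i) * V i + √((k : ℝ) - 1 - i) * V (i + 1) = 0 := hUi
        rw [hVi, mul_zero, zero_add] at hu
        exact (mul_eq_zero.1 hu).resolve_left (Real.sqrt_pos.2 (by linarith)).ne'
      have hr := congrFun hv ⟨i + 1, h⟩
      rw [lagB_mulVec_succ γ U i h] at hr
      simp only [Pi.smul_apply, smul_eq_mul] at hr
      rw [hV, hUi, mul_zero, mul_zero, add_zero] at hr
      exact ⟨hV, (mul_eq_zero.1 hr).resolve_left (Real.sqrt_pos.2 (by linarith)).ne'⟩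
  ext j
  exact (key j j.2).1

theorem Lag_vector_ne_zero {k : ℕ} (hk : 0 < k) {γ : ℝ} (hγ : 0 < γ) (x : ℝ) :
    (fun j : Fin k => Lag γ (k - 1 - (j : ℕ)) x) ≠ 0 := by
  intro h
  have h' := congrFun h ⟨k - 1, by omega⟩
  simp only [Nat.sub_self, Lag, Pi.zero_apply] at h'
  exact (Real.rpow_pos_of_pos (Real.Gamma_pos_of_pos (by linarith)) _).ne' h'

theorem charpoly_isRoot_iff_exists_mulVec {n : Type*} [Fintype n] [DecidableEq n]
    (A : Matrix n n ℝ) (x : ℝ) :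
    A.charpoly.IsRoot x ↔ ∃ v, v ≠ 0 ∧ A.mulVec v = x • v := by
  rw [Polynomial.IsRoot, Matrix.eval_charpoly, ← Matrix.exists_mulVec_eq_zero_iff]
  simp only [Matrix.sub_mulVec, Matrix.scalar_apply, sub_eq_zero, Matrix.diagonal_const_mulVec,
    eq_comm (a := x • _)]

theorem Lag_eq_zero_of_lagL_mulVec_eq_smul {k : ℕ} (hk : 0 < k) {γ : ℝ} (hγ : 0 < γ) {x : ℝ}
    {v : Fin k → ℝ} (hv0 : v ≠ 0) (hv : (lagL k γ).mulVec v = x • v) : Lag (γ - 1) k x = 0 := by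
  have hsymm : (lagL k γ)ᵀ = lagL k γ := by
    simp [lagL, Matrix.transpose_mul]
  have h : v ⬝ᵥ (lagL k γ).mulVec (fun j : Fin k => Lag γ (k - 1 - (j : ℕ)) x) =
      (lagL k γ).mulVec v ⬝ᵥ (fun j : Fin k => Lag γ (k - 1 - (j : ℕ)) x) := by
    rw [Matrix.dotProduct_mulVec, ← Matrix.mulVec_transpose, hsymm]
  rw [hv, lagL_mulVec_Lag hk hγ, dotProduct_sub, dotProduct_smul, smul_dotProduct,
    sub_eq_self, dotProduct_single] at h
  have hfirst : v ⟨0, hk⟩ ≠ 0 := fun h0 => hv0 (eq_zero_of_lagL_mulVec_eq_smul hk hγ hv h0)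
  have hsq : √(k : ℝ) ≠ 0 := (Real.sqrt_pos.2 (by exact_mod_cast hk)).ne'
  exact (mul_eq_zero.1 ((mul_eq_zero.1 h).resolve_left hfirst)).resolve_left hsq

theorem lagL_eigenvector (k : ℕ) (hk : 1 ≤ k) (γ : ℝ) (hγ : 0 < γ)
    (l : ℝ) (hroot : Lag (γ - 1) k l = 0) :
    (fun j : Fin k => Lag γ (k - 1 - (j:ℕ)) l) ≠ 0 ∧
    (lagL k γ).mulVec (fun j : Fin k => Lag γ (k - 1 - (j:ℕ)) l) =
      l • (fun j : Fin k => Lag γ (k - 1 - (j:ℕ)) l) ∧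
    ∀ x : ℝ, (lagL k γ).charpoly.IsRoot x ↔ Lag (γ - 1) k x = 0 := by
  have heig : ∀ x, Lag (γ - 1) k x = 0 →
      (lagL k γ).mulVec (fun j : Fin k => Lag γ (k - 1 - (j:ℕ)) x) =
        x • (fun j : Fin k => Lag γ (k - 1 - (j:ℕ)) x) := by
    intro x hx
    rw [lagL_mulVec_Lag hk hγ, hx, mul_zero, Pi.single_zero, sub_zero]
  refine ⟨Lag_vector_ne_zero hk hγ l, heig l hroot, fun x => ?_⟩
  rw [charpoly_isRoot_iff_exists_mulVec]
  constructor
  · rintro ⟨v, hv0, hv⟩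
    exact Lag_eq_zero_of_lagL_mulVec_eq_smul hk hγ hv0 hv
  · exact fun hx => ⟨_, Lag_vector_ne_zero hk hγ x, heig x hx⟩

end
end
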